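/- Let N ≥ 4, β > 0, and 1 < γ < 2(N−1)/N. There is no global classical solution with positive total mass on [0,∞) of the N-dimensional Euler–Poisson equations with frictional damping βρu whose initial total energy satisfies E(0) ≤ 0; i.e., every such classical solution with E(0) ≤ 0 blows up in finite time. -/

import Mathlib

open MeasureTheory Real Filter
open scoped RealInnerProductSpace Topology

noncomputable section

/-- Euclidean space `ℝ^N`. -/
abbrev Euc (N : ℕ) := EuclideanSpace ℝ (Fin N)

/-- Divergence of a vector field on `ℝ^N`. -/
def ediv {N : ℕ} (v : Euc N → Euc N) (x : Euc N) : ℝ :=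
  ∑ i, fderiv ℝ (fun y => v y i) x (EuclideanSpace.single i 1)

/-- Partial derivative of a scalar field in the `i`-th coordinate direction. -/
def epartial {N : ℕ} (i : Fin N) (f : Euc N → ℝ) (x : Euc N) : ℝ :=
  fderiv ℝ f x (EuclideanSpace.single i 1)

/-- Green's function of the Poisson equation in `ℝ^N`:
`log |x|` for `N = 2` and `-|x|^(2-N)` for `N ≥ 3`. -/
def green (N : ℕ) (x : Euc N) : ℝ :=
  if N = 2 then Real.log ‖x‖ else -(‖x‖ ^ ((2 : ℝ) - (N : ℝ)))

/-- Gravitational potential `Φ(t,x) = g ∫ G(x-y) ρ(t,y) dy`. -/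
def potential (N : ℕ) (g : ℝ) (ρ : ℝ → Euc N → ℝ) (t : ℝ) (x : Euc N) : ℝ :=
  g * ∫ y, green N (x - y) * ρ t y

/-- A classical solution on `[0,T)` (with `T : EReal`, so `T = ⊤` means a global
solution) of the `N`-dimensional Euler–Poisson equations with pressure
`P = K ρ^γ`, damping constant `β` and gravitational constant `g`:
nonnegative `C¹` density `ρ`, `C¹` velocity `u`, with `ρ(t,·)` supported in a
fixed bounded open set `Ω`, satisfying the continuity and momentum equations
pointwise. -/
structure IsEPSolution (N : ℕ) (K γ β g : ℝ) (Ω : Set (Euc N)) (T : EReal)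
    (ρ : ℝ → Euc N → ℝ) (u : ℝ → Euc N → Euc N) : Prop where
  rho_nonneg : ∀ t x, 0 ≤ ρ t x
  rho_C1 : ContDiff ℝ 1 (fun p : ℝ × Euc N => ρ p.1 p.2)
  u_C1 : ContDiff ℝ 1 (fun p : ℝ × Euc N => u p.1 p.2)
  omega_open : IsOpen Ω
  omega_bounded : Bornology.IsBounded Ω
  support_subset : ∀ t : ℝ, 0 ≤ t → (t : EReal) < T → Function.support (ρ t) ⊆ Ω
  continuity_eq : ∀ t : ℝ, 0 ≤ t → (t : EReal) < T → ∀ x : Euc N,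
    deriv (fun s => ρ s x) t + ediv (fun y => ρ t y • u t y) x = 0
  momentum_eq : ∀ t : ℝ, 0 ≤ t → (t : EReal) < T → ∀ x : Euc N, ∀ j : Fin N,
    deriv (fun s => ρ s x * u s x j) t
      + (∑ i, epartial i (fun y => ρ t y * u t y i * u t y j) x)
      + epartial j (fun y => K * ρ t y ^ γ) x
      = -(ρ t x * epartial j (potential N g ρ t) x) - β * ρ t x * u t x j

/-- Total energy (case `γ > 1`):
`E(t) = ∫_Ω (½ ρ|u|² + P/(γ-1) + ½ ρΦ) dx` with `P = K ρ^γ`. -/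
def energy (N : ℕ) (K γ g : ℝ) (Ω : Set (Euc N)) (ρ : ℝ → Euc N → ℝ)
    (u : ℝ → Euc N → Euc N) (t : ℝ) : ℝ :=
  ∫ x in Ω, ((1 / 2) * ρ t x * ‖u t x‖ ^ 2 + K * ρ t x ^ γ / (γ - 1)
    + (1 / 2) * ρ t x * potential N g ρ t x)

/-- Isothermal total energy (case `γ = 1`, `P = Kρ`):
`E(t) = ∫_Ω (½ ρ|u|² + Kρ log ρ + ½ ρΦ) dx` (note `ρ log ρ = 0` where `ρ = 0`
since `Real.log 0 = 0`). -/
def energyIso (N : ℕ) (K g : ℝ) (Ω : Set (Euc N)) (ρ : ℝ → Euc N → ℝ)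
    (u : ℝ → Euc N → Euc N) (t : ℝ) : ℝ :=
  ∫ x in Ω, ((1 / 2) * ρ t x * ‖u t x‖ ^ 2 + K * ρ t x * Real.log (ρ t x)
    + (1 / 2) * ρ t x * potential N g ρ t x)

/-- Second inertia function `H(t) = ∫_Ω ρ(t,x)|x|² dx`. -/
def inertia (N : ℕ) (Ω : Set (Euc N)) (ρ : ℝ → Euc N → ℝ) (t : ℝ) : ℝ :=
  ∫ x in Ω, ρ t x * ‖x‖ ^ 2

/-- Maximal radius of the support of `ρ(t,·)`. -/
def maxRadius (N : ℕ) (ρ : ℝ → Euc N → ℝ) (t : ℝ) : ℝ :=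
  sSup ((fun x : Euc N => ‖x‖) '' Function.support (ρ t))


lemma ep_hasDerivAt_param {E : Type*} [NormedAddCommGroup E] [NormedSpace ℝ E] [MeasurableSpace E]
    [BorelSpace E] [SecondCountableTopology E] (μ : Measure E) (f : ℝ × E → ℝ) (hf : ContDiff ℝ 1 f)
    (S : Set E) (hS : IsCompact S) (k : E → ℝ) (hk : IntegrableOn k S μ) (t : ℝ) :
    HasDerivAt (fun t => ∫ x in S, f (t, x) * k x ∂μ)
      (∫ x in S, deriv (fun s => f (s, x)) t * k x ∂μ) t := by
  have hd : ∀ r x, HasDerivAt (fun s => f (s, x)) (fderiv ℝ f (r, x) (1, 0)) r := by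
    intro r x
    have h1 : HasFDerivAt f (fderiv ℝ f (r, x)) (r, x) :=
      (hf.differentiable (by norm_num) _).hasFDerivAt
    have h2 : HasDerivAt (fun s : ℝ => (s, x)) ((1 : ℝ), (0 : E)) r :=
      (hasDerivAt_id r).prodMk (hasDerivAt_const r x)
    exact h1.comp_hasDerivAt r h2
  have hcont : Continuous (fun p : ℝ × E => fderiv ℝ f p (1, 0)) :=
    (hf.continuous_fderiv (by norm_num)).clm_apply continuous_const
  obtain ⟨C, hC⟩ := ((isCompact_Icc (a := t - 1) (b := t + 1)).prod hS).exists_bound_of_continuousOn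
    hcont.continuousOn
  have hmeas : ∀ φ : E → ℝ, Continuous φ → AEStronglyMeasurable (fun x => φ x * k x) (μ.restrict S) :=
    fun φ hφ => hφ.aestronglyMeasurable.mul hk.aestronglyMeasurable
  have key := hasDerivAt_integral_of_dominated_loc_of_deriv_le (μ := μ.restrict S)
    (F := fun t x => f (t, x) * k x) (F' := fun t x => fderiv ℝ f (t, x) (1, 0) * k x)
    (x₀ := t) (s := Metric.ball t 1) (bound := fun x => C * ‖k x‖)
    (Metric.ball_mem_nhds t one_pos)
    (Eventually.of_forall fun r => hmeas _ (hf.continuous.comp (by fun_prop)))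
    ?_ (hmeas _ (hcont.comp (by fun_prop))) ?_ (hk.norm.const_mul C) ?_
  · simp only [(hd _ _).deriv]
    exact key.2
  · obtain ⟨C', hC'⟩ := hS.exists_bound_of_continuousOn
      (f := fun x => f (t, x)) (hf.continuous.comp (by fun_prop)).continuousOn
    refine Integrable.mono' (hk.norm.const_mul C')
      (hmeas _ (hf.continuous.comp (by fun_prop))) ?_
    refine (ae_restrict_mem₀ (hS.measurableSet.nullMeasurableSet)).mono fun x hx => ?_
    rw [norm_mul]
    gcongr
    exact hC' x hx
  · refine (ae_restrict_mem₀ (hS.measurableSet.nullMeasurableSet)).mono fun x hx r hr => ?_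
    rw [norm_mul]
    gcongr
    apply hC (r, x)
    rw [Metric.mem_ball, Real.dist_eq, abs_lt] at hr
    exact ⟨⟨by linarith, by linarith⟩, hx⟩
  · exact Eventually.of_forall fun x r _ => (hd r x).mul_const _

lemma ep_hasDerivAt_param' {N : ℕ} (f : ℝ × Euc N → ℝ) (hf : ContDiff ℝ 1 f)
    (S : Set (Euc N)) (hS : IsCompact S) (t : ℝ) :
    HasDerivAt (fun t => ∫ x in S, f (t, x)) (∫ x in S, deriv (fun s => f (s, x)) t) t := by
  have := ep_hasDerivAt_param volume f hf S hS (fun _ => 1)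
    (integrableOn_const hS.measure_lt_top.ne) t
  simpa using this

lemma ep_cont_epartial {N : ℕ} {f : Euc N → ℝ} (hf : ContDiff ℝ 1 f) (i : Fin N) :
    Continuous (epartial i f) :=
  (hf.continuous_fderiv (by norm_num)).clm_apply continuous_const

lemma ep_partial_zero {N : ℕ} {f : Euc N → ℝ} {R : ℝ}
    (h : ∀ x, x ∉ Metric.closedBall (0 : Euc N) R → f x = 0) (i : Fin N) :
    ∀ x, x ∉ Metric.closedBall (0 : Euc N) R → epartial i f x = 0 := by
  intro x hx
  have : f =ᶠ[𝓝 x] fun _ => 0 := by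
    filter_upwards [Metric.isClosed_closedBall.isOpen_compl.mem_nhds hx] with y hy
    exact h y hy
  unfold epartial
  rw [this.fderiv_eq]; simp

lemma ep_cs {N : ℕ} {f : Euc N → ℝ} {R : ℝ}
    (h : ∀ x, x ∉ Metric.closedBall (0 : Euc N) R → f x = 0) : HasCompactSupport f :=
  HasCompactSupport.intro (isCompact_closedBall _ _) h

lemma ep_setint {N : ℕ} {f : Euc N → ℝ} {R : ℝ}
    (h : ∀ x, x ∉ Metric.closedBall (0 : Euc N) R → f x = 0) :
    ∫ x in Metric.closedBall (0 : Euc N) R, f x = ∫ x, f x :=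
  setIntegral_eq_integral_of_forall_compl_eq_zero h

lemma ep_int_partial {N : ℕ} {f : Euc N → ℝ} {R : ℝ} (hf : ContDiff ℝ 1 f)
    (h : ∀ x, x ∉ Metric.closedBall (0 : Euc N) R → f x = 0) (i : Fin N) :
    ∫ x in Metric.closedBall (0 : Euc N) R, epartial i f x = 0 := by
  rw [ep_setint (ep_partial_zero h i)]
  have := integral_mul_fderiv_eq_neg_fderiv_mul_of_integrable (μ := (volume : Measure (Euc N)))
    (f := fun _ => (1 : ℝ)) (g := f) (v := EuclideanSpace.single i 1) (by simp)
    (by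
      simp only [one_mul]
      exact (ep_cont_epartial hf i).integrable_of_hasCompactSupport
          (ep_cs (ep_partial_zero h i)))
    (by simpa using hf.continuous.integrable_of_hasCompactSupport (ep_cs h))
    (by simp) (fun x _ => hf.differentiable (by norm_num) x)
  simp only [one_mul] at this
  refine Eq.trans this ?_
  simp

lemma ep_mul {N : ℕ} {f g : Euc N → ℝ} (hf : ContDiff ℝ 1 f) (hg : ContDiff ℝ 1 g) (i : Fin N)
    (x : Euc N) : epartial i (fun y => f y * g y) x = epartial i f x * g x + f x * epartial i g x := by
  unfold epartial
  rw [fderiv_fun_mul (hf.differentiable (by norm_num) x) (hg.differentiable (by norm_num) x)]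
  simp
  ring

lemma ep_intOn {N : ℕ} {f : Euc N → ℝ} (R : ℝ) (hf : Continuous f) :
    IntegrableOn f (Metric.closedBall (0 : Euc N) R) :=
  hf.continuousOn.integrableOn_compact (isCompact_closedBall _ _)

lemma ep_ibp {N : ℕ} {f g : Euc N → ℝ} {R : ℝ} (hf : ContDiff ℝ 1 f) (hg : ContDiff ℝ 1 g)
    (h : ∀ x, x ∉ Metric.closedBall (0 : Euc N) R → f x = 0) (i : Fin N) :
    ∫ x in Metric.closedBall (0 : Euc N) R, epartial i f x * g x =
     - ∫ x in Metric.closedBall (0 : Euc N) R, f x * epartial i g x := by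
  have h1 := ep_int_partial (R := R) (hf.mul hg) (fun x hx => by simp [h x hx]) i
  have h2 : (fun x => epartial i (fun y => f y * g y) x) =
    fun x => epartial i f x * g x + f x * epartial i g x := funext (ep_mul hf hg i)
  rw [h2] at h1
  rw [integral_add (ep_intOn R ((ep_cont_epartial hf i).fun_mul hg.continuous))
    (ep_intOn R (hf.continuous.fun_mul (ep_cont_epartial hg i)))] at h1
  linarith

lemma ep_green {N : ℕ} (hN : 4 ≤ N) (x : Euc N) : green N x = -(‖x‖ ^ ((2 : ℝ) - (N : ℝ))) := by
  unfold green; rw [if_neg (by omega)]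

lemma ep_green_meas {N : ℕ} (hN : 4 ≤ N) : Measurable (green N) := by
  have : green N = fun x : Euc N => -(‖x‖ ^ ((2 : ℝ) - (N : ℝ))) := funext (ep_green hN)
  rw [this]
  fun_prop

lemma ep_green_ball {N : ℕ} (hN : 4 ≤ N) (R : ℝ) :
    IntegrableOn (green N) (Metric.ball (0 : Euc N) R) := by
  have : green N = fun x : Euc N => (fun r : ℝ => -(r ^ ((2 : ℝ) - (N : ℝ)))) ‖x‖ := funext (ep_green hN)
  rw [this]
  have : Nonempty (Fin N) := ⟨⟨0, by omega⟩⟩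
  have : Nontrivial (Euc N) := inferInstance
  refine (integrableOn_fun_norm_addHaar (volume : Measure (Euc N)) (r := R)
    (f := (fun r : ℝ => -(r ^ ((2 : ℝ) - (N : ℝ)))))).2 ?_
  have h2 : IntegrableOn (fun y : ℝ => -y) (Set.Ioo 0 R) :=
    (continuous_neg.continuousOn.integrableOn_compact (isCompact_Icc (a := 0) (b := R))).mono_set
      Set.Ioo_subset_Icc_self
  refine h2.congr_fun (fun y hy => ?_) measurableSet_Ioo
  have hy0 : 0 < y := hy.1
  have : Module.finrank ℝ (Euc N) = N := by simp
  rw [this]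
  simp only [smul_eq_mul, mul_neg, neg_inj]
  rw [← Real.rpow_natCast, ← Real.rpow_add hy0]
  rw [Nat.cast_sub (by omega)]
  norm_num

lemma ep_green_cball {N : ℕ} (hN : 4 ≤ N) (R : ℝ) :
    IntegrableOn (green N) (Metric.closedBall (0 : Euc N) R) :=
  (ep_green_ball hN (R + 1)).mono_set (Metric.closedBall_subset_ball (by linarith))

lemma ep_green_loc {N : ℕ} (hN : 4 ≤ N) : LocallyIntegrable (green N) := by
  rw [locallyIntegrable_iff]
  intro k hk
  obtain ⟨R, hR⟩ := hk.isBounded.subset_closedBall (0 : Euc N)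
  exact (ep_green_cball hN R).mono_set hR

lemma ep_green_neg {N : ℕ} (x y : Euc N) : green N (x - y) = green N (y - x) := by
  unfold green; rw [norm_sub_rev]

lemma ep_green_smul {N : ℕ} (hN : 4 ≤ N) (l : ℝ) (hl : 0 < l) (x : Euc N) :
    green N (l • x) = l ^ ((2 : ℝ) - (N : ℝ)) * green N x := by
  rw [ep_green hN, ep_green hN, norm_smul, Real.norm_of_nonneg hl.le,
    Real.mul_rpow hl.le (norm_nonneg _)]
  ring

/-- Newtonian potential of `f`. -/
def epV (N : ℕ) (f : Euc N → ℝ) (x : Euc N) : ℝ := ∫ y, green N (x - y) * f y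

lemma epV_eq {N : ℕ} (f : Euc N → ℝ) (x : Euc N) : epV N f x = ∫ z, green N z * f (x - z) := by
  unfold epV
  rw [← integral_sub_left_eq_self _ volume x]
  simp

lemma epV_conv {N : ℕ} (f : Euc N → ℝ) :
    epV N f = MeasureTheory.convolution (green N) f (ContinuousLinearMap.mul ℝ ℝ) volume := by
  funext x
  rw [epV_eq]; rfl

lemma epV_cont {N : ℕ} (hN : 4 ≤ N) {f : Euc N → ℝ} {R : ℝ} (hf : Continuous f)
    (h : ∀ x, x ∉ Metric.closedBall (0 : Euc N) R → f x = 0) : Continuous (epV N f) := by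
  rw [epV_conv]
  exact (ep_cs h).continuous_convolution_right _ (ep_green_loc hN) hf

lemma epV_C1 {N : ℕ} (hN : 4 ≤ N) {f : Euc N → ℝ} {R : ℝ} (hf : ContDiff ℝ 1 f)
    (h : ∀ x, x ∉ Metric.closedBall (0 : Euc N) R → f x = 0) : ContDiff ℝ 1 (epV N f) := by
  rw [epV_conv]
  exact (ep_cs h).contDiff_convolution_right _ (ep_green_loc hN) hf

lemma epV_partial {N : ℕ} (hN : 4 ≤ N) {f : Euc N → ℝ} {R : ℝ} (hf : ContDiff ℝ 1 f)
    (h : ∀ x, x ∉ Metric.closedBall (0 : Euc N) R → f x = 0) (i : Fin N) (x : Euc N) :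
    epartial i (epV N f) x = epV N (epartial i f) x := by
  have := (ep_cs h).hasFDerivAt_convolution_right (ContinuousLinearMap.mul ℝ ℝ)
    (ep_green_loc hN) hf x
  unfold epartial
  rw [epV_conv f, this.fderiv, epV_eq]
  rw [convolution_precompR_apply _ (ep_green_loc hN) ((ep_cs h).fderiv ℝ)
    (hf.continuous_fderiv (by norm_num))]
  rfl

lemma ep_prod_int {N : ℕ} (hN : 4 ≤ N) (R : ℝ) :
    IntegrableOn (fun p : Euc N × Euc N => green N (p.1 - p.2))
      (Metric.closedBall (0 : Euc N) R ×ˢ Metric.closedBall (0 : Euc N) R) := by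
  have h1 : Integrable ((Metric.closedBall (0 : Euc N) R).indicator (fun _ => (1 : ℝ))) :=
    (integrable_indicator_iff measurableSet_closedBall).2
      (integrableOn_const (isCompact_closedBall _ _).measure_lt_top.ne)
  have h2 : Integrable ((Metric.closedBall (0 : Euc N) (2 * R)).indicator (green N)) :=
    (integrable_indicator_iff measurableSet_closedBall).2 (ep_green_cball hN _)
  have h3 := (h1.convolution_integrand (ContinuousLinearMap.mul ℝ ℝ) h2).integrableOn
    (s := (Metric.closedBall (0 : Euc N) R ×ˢ Metric.closedBall (0 : Euc N) R))
  refine IntegrableOn.congr_fun h3 (fun p hp => ?_)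
    (measurableSet_closedBall.prod measurableSet_closedBall)
  have hx : ‖p.1‖ ≤ R := by simpa using hp.1
  have hy : ‖p.2‖ ≤ R := by simpa using hp.2
  have hxy : ‖p.1 - p.2‖ ≤ 2 * R := (norm_sub_le _ _).trans (by linarith)
  simp [Set.indicator, hy, hxy]

lemma ep_prod_int' {N : ℕ} (hN : 4 ≤ N) (R : ℝ) {F : Euc N × Euc N → ℝ} (hF : Continuous F) :
    IntegrableOn (fun p : Euc N × Euc N => F p * green N (p.1 - p.2))
      (Metric.closedBall (0 : Euc N) R ×ˢ Metric.closedBall (0 : Euc N) R) :=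
  (ep_prod_int hN R).continuousOn_mul hF.continuousOn
    ((isCompact_closedBall _ _).prod (isCompact_closedBall _ _))

lemma ep_double {N : ℕ} (hN : 4 ≤ N) (R : ℝ) {f h : Euc N → ℝ} (hf : Continuous f)
    (hh : Continuous h) (h0 : ∀ x, x ∉ Metric.closedBall (0 : Euc N) R → h x = 0) :
    ∫ p in Metric.closedBall (0 : Euc N) R ×ˢ Metric.closedBall (0 : Euc N) R,
      f p.1 * h p.2 * green N (p.1 - p.2) = 
    ∫ x in Metric.closedBall (0 : Euc N) R, f x * epV N h x := by
  have hi := ep_prod_int' hN R (F := fun p => f p.1 * h p.2) (by fun_prop)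
  rw [Measure.volume_eq_prod] at hi ⊢
  rw [setIntegral_prod _ hi]
  congr 1
  funext x
  rw [epV, ← ep_setint (R := R) (fun y hy => by simp [h0 y hy]), ← integral_const_mul]
  congr 1
  funext y
  ring

lemma ep_double' {N : ℕ} (hN : 4 ≤ N) (R : ℝ) {f h : Euc N → ℝ} (hf : Continuous f)
    (hh : Continuous h) (h0 : ∀ x, x ∉ Metric.closedBall (0 : Euc N) R → f x = 0) :
    ∫ p in Metric.closedBall (0 : Euc N) R ×ˢ Metric.closedBall (0 : Euc N) R,
      f p.1 * h p.2 * green N (p.1 - p.2) = 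
    ∫ x in Metric.closedBall (0 : Euc N) R, h x * epV N f x := by
  rw [← ep_double hN R hh hf h0]
  rw [Measure.volume_eq_prod, ← setIntegral_prod_swap]
  congr 1
  funext p
  simp only [Prod.fst_swap, Prod.snd_swap]
  rw [ep_green_neg]
  ring

lemma ep_symm {N : ℕ} (hN : 4 ≤ N) (R : ℝ) {f h : Euc N → ℝ} (hf : Continuous f)
    (hh : Continuous h) (f0 : ∀ x, x ∉ Metric.closedBall (0 : Euc N) R → f x = 0)
    (h0 : ∀ x, x ∉ Metric.closedBall (0 : Euc N) R → h x = 0) :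
    ∫ x in Metric.closedBall (0 : Euc N) R, f x * epV N h x =
    ∫ x in Metric.closedBall (0 : Euc N) R, h x * epV N f x := by
  rw [← ep_double hN R hf hh h0, ep_double' hN R hf hh f0]

lemma ep_euler {N : ℕ} (hN : 4 ≤ N) (R : ℝ) (hR : 0 ≤ R) {A : Euc N → ℝ} (hA : ContDiff ℝ 1 A)
    (h0 : ∀ x, x ∉ Metric.closedBall (0 : Euc N) R → A x = 0) :
    ∫ z, green N z * fderiv ℝ A z z = -2 * ∫ z, green N z * A z := by
  have hA' : ContDiff ℝ 1 (fun p : ℝ × Euc N => A (p.1 • p.2)) := by fun_prop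
  have key := ep_hasDerivAt_param volume (fun p : ℝ × Euc N => A (p.1 • p.2)) hA'
    (Metric.closedBall (0 : Euc N) (2 * R)) (isCompact_closedBall _ _) (green N)
    (ep_green_cball hN _) 1
  have hd : ∀ z : Euc N, deriv (fun s : ℝ => A (s • z)) 1 = fderiv ℝ A z z := by
    intro z
    have h1 : HasFDerivAt A (fderiv ℝ A z) ((1 : ℝ) • z) := by
      rw [one_smul]; exact (hA.differentiable (by norm_num) z).hasFDerivAt
    have h2 : HasDerivAt (fun s : ℝ => s • z) ((1 : ℝ) • z) 1 := (hasDerivAt_id (1 : ℝ)).smul_const z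
    have := (h1.comp_hasDerivAt (1 : ℝ) h2).deriv
    simpa [Function.comp_def] using this
  simp only [hd] at key
  have hz : ∀ x, x ∉ Metric.closedBall (0 : Euc N) (2 * R) → x ∉ Metric.closedBall (0 : Euc N) R := by
    intro x hx hx'
    simp at hx hx'
    linarith
  have e1 : ∫ z in Metric.closedBall (0 : Euc N) (2 * R), fderiv ℝ A z z * green N z
      = ∫ z, green N z * fderiv ℝ A z z := by
    rw [ep_setint]
    · simp only [mul_comm]
    · intro x hx
      have : A =ᶠ[𝓝 x] fun _ => 0 := by
        filter_upwards [Metric.isClosed_closedBall.isOpen_compl.mem_nhds (hz x hx)] with y hy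
        exact h0 y hy
      rw [this.fderiv_eq]; simp
  rw [e1] at key
  have e2 : (fun l : ℝ => ∫ z in Metric.closedBall (0 : Euc N) (2 * R), A (l • z) * green N z)
      =ᶠ[𝓝 1] fun l => l ^ (-2 : ℝ) * ∫ z, green N z * A z := by
    filter_upwards [lt_mem_nhds (show (1 / 2 : ℝ) < 1 by norm_num)] with l hl
    have hl0 : 0 < l := by linarith
    rw [ep_setint]
    · have := Measure.integral_comp_smul_of_nonneg (volume : Measure (Euc N))
        (fun z => A z * green N z) l (hR := hl0.le)
      simp only [ep_green_smul hN l hl0] at this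
      have h3 : ∀ z, A (l • z) * (l ^ ((2 : ℝ) - N) * green N z)
        = l ^ ((2 : ℝ) - N) * (A (l • z) * green N z) := fun z => by ring
      simp only [h3] at this
      rw [integral_const_mul] at this
      have h4 : Module.finrank ℝ (Euc N) = N := by simp
      rw [h4, smul_eq_mul] at this
      have h5 : l ^ (-2 : ℝ) * l ^ ((2 : ℝ) - N) = (l ^ N)⁻¹ := by
        rw [← Real.rpow_add hl0, ← Real.rpow_natCast, ← Real.rpow_neg hl0.le]
        congr 1; ring
      have h6 : l ^ ((2 : ℝ) - N) ≠ 0 := (Real.rpow_pos_of_pos hl0 _).ne'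
      apply mul_left_cancel₀ h6
      rw [this, ← h5]
      simp only [mul_comm (A _)]
      ring
    · intro x hx
      have : l • x ∉ Metric.closedBall (0 : Euc N) R := by
        simp only [Metric.mem_closedBall, dist_zero_right, not_le, norm_smul,
          Real.norm_of_nonneg hl0.le] at hx ⊢
        nlinarith [norm_nonneg x]
      simp [h0 _ this]
  have k2 := key.congr_of_eventuallyEq e2.symm
  have k3 := ((Real.hasDerivAt_rpow_const (x := 1) (p := -2) (Or.inl one_ne_zero)).mul_const
    (∫ z, green N z * A z))
  have := k2.unique k3
  rw [this]
  simp

lemma ep_sum_partial {N : ℕ} (f : Euc N → ℝ) (w z : Euc N) :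
    fderiv ℝ f w z = ∑ j, z j * epartial j f w := by
  have : z = ∑ j, z j • EuclideanSpace.single j (1 : ℝ) := by
    ext i; simp [Finset.sum_apply, Pi.single_apply]
  conv_lhs => rw [this]
  simp [epartial]

lemma ep_green_int {N : ℕ} (hN : 4 ≤ N) {h : Euc N → ℝ} (hh : Continuous h)
    (hc : HasCompactSupport h) : Integrable (fun z => green N z * h z) :=
  (ep_green_loc hN).integrable_smul_right_of_hasCompactSupport hh hc

lemma epV_euler {N : ℕ} (hN : 4 ≤ N) {f : Euc N → ℝ} {R : ℝ} (hf : ContDiff ℝ 1 f) (hR : 0 ≤ R)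
    (h0 : ∀ x, x ∉ Metric.closedBall (0 : Euc N) R → f x = 0) (x : Euc N) :
    ∑ j, x j * epartial j (epV N f) x =
      2 * epV N f x + epV N (fun y => ∑ j, y j * epartial j f y) x := by
  have hA : ContDiff ℝ 1 (fun z => f (x - z)) := by fun_prop
  have h1 := ep_euler hN (R + ‖x‖) (by positivity) hA (fun z hz => by
    apply h0
    simp only [Metric.mem_closedBall, dist_zero_right, not_le] at hz ⊢
    have := norm_sub_norm_le z x
    rw [norm_sub_rev] at this
    linarith)
  have h2 : ∀ z, fderiv ℝ (fun z => f (x - z)) z z = - fderiv ℝ f (x - z) z := by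
    intro z
    have h3 : HasFDerivAt f (fderiv ℝ f (x - z)) (x - z) :=
      (hf.differentiable (by norm_num) _).hasFDerivAt
    have h4 : HasFDerivAt (fun z : Euc N => x - z) (-ContinuousLinearMap.id ℝ (Euc N)) z :=
      (hasFDerivAt_id z).const_sub x
    have := (h3.comp z h4).fderiv
    simp only [Function.comp_def] at this
    rw [this]; simp
  simp only [h2, mul_neg, integral_neg] at h1
  have cs : HasCompactSupport (fderiv ℝ f) := (ep_cs h0).fderiv ℝ
  have cf := hf.continuous_fderiv (by norm_num)
  have cs2 : ∀ g : Euc N → ℝ, HasCompactSupport g → HasCompactSupport (fun z => g (x - z)) :=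
    fun g hg => hg.comp_homeomorph (Homeomorph.subLeft x)
  have c1 : Continuous (fun y => fderiv ℝ f y x) := cf.clm_apply continuous_const
  have c2 : Continuous (fun y => fderiv ℝ f y y) := cf.clm_apply continuous_id
  have s1 : HasCompactSupport (fun y => fderiv ℝ f y x) := by
    refine cs.mono (fun y hy hy' => hy ?_)
    simp [hy']
  have s2 : HasCompactSupport (fun y => fderiv ℝ f y y) := by
    refine cs.mono (fun y hy hy' => hy ?_)
    simp [hy']
  have e1 : ∑ j, x j * epartial j (epV N f) x = ∫ z, green N z * fderiv ℝ f (x - z) x := by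
    simp only [epV_partial hN hf h0, epV_eq, ep_sum_partial, Finset.mul_sum]
    rw [integral_finsetSum]
    · congr 1; funext j
      rw [← integral_const_mul]
      congr 1; funext z; ring
    · intro j _
      apply ep_green_int hN (h := fun z => x j * epartial j f (x - z))
      · have := ep_cont_epartial hf j
        fun_prop
      · exact (cs2 _ (ep_cs (ep_partial_zero h0 j))).mul_left
  have e2 : epV N (fun y => ∑ j, y j * epartial j f y) x = 
     ∫ z, green N z * fderiv ℝ f (x - z) (x - z) := by
    rw [epV_eq]; simp only [ep_sum_partial]
  have e3 : ∫ z, green N z * fderiv ℝ f (x - z) (x - z) = 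
     (∫ z, green N z * fderiv ℝ f (x - z) x) - ∫ z, green N z * fderiv ℝ f (x - z) z := by
    have : ∀ z, green N z * fderiv ℝ f (x - z) z = green N z * fderiv ℝ f (x - z) x
       - green N z * fderiv ℝ f (x - z) (x - z) := by
      intro z
      rw [← mul_sub, ← map_sub]; simp
    simp only [this]
    rw [integral_sub]
    · ring
    · exact ep_green_int hN (h := fun z => fderiv ℝ f (x - z) x) 
        (c1.comp (continuous_sub_left x)) (cs2 (fun y => fderiv ℝ f y x) s1)
    · exact ep_green_int hN (h := fun z => fderiv ℝ f (x - z) (x - z)) 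
        (c2.comp (continuous_sub_left x)) (cs2 (fun y => fderiv ℝ f y y) s2)
  rw [e1, e2, e3, epV_eq]
  linarith

/-- virial identity for the potential -/
lemma ep_virial {N : ℕ} (hN : 4 ≤ N) {f : Euc N → ℝ} {R : ℝ} (hf : ContDiff ℝ 1 f) (hR : 0 ≤ R)
    (h0 : ∀ x, x ∉ Metric.closedBall (0 : Euc N) R → f x = 0) :
    ∫ x in Metric.closedBall (0 : Euc N) R, f x * ∑ j, x j * epartial j (epV N f) x =
      -(((N : ℝ) - 2) / 2) * ∫ x in Metric.closedBall (0 : Euc N) R, f x * epV N f x := by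
  have cV := epV_cont hN hf.continuous h0
  have V1 := epV_C1 hN hf h0
  have cj : ∀ j, Continuous (epartial j f) := ep_cont_epartial hf
  have cVj : ∀ j, Continuous (epartial j (epV N f)) := ep_cont_epartial V1
  have cf := hf.continuous
  have cH : Continuous (fun y : Euc N => ∑ j, y j * epartial j f y) := by fun_prop
  have H0 : ∀ x, x ∉ Metric.closedBall (0 : Euc N) R → ∑ j, x j * epartial j f x = 0 := by
    intro x hx
    simp [ep_partial_zero h0 _ x hx]
  have cVH := epV_cont hN cH H0
  have a1 : ∫ x in Metric.closedBall (0 : Euc N) R, f x * ∑ j, x j * epartial j (epV N f) x =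
     2 * (∫ x in Metric.closedBall (0 : Euc N) R, f x * epV N f x) + 
       ∫ x in Metric.closedBall (0 : Euc N) R, f x * epV N (fun y => ∑ j, y j * epartial j f y) x := by
    rw [← integral_const_mul, ← integral_add (ep_intOn R (by fun_prop)) (ep_intOn R (by fun_prop))]
    congr 1; funext x
    rw [epV_euler hN hf hR h0]; ring
  have a2 := ep_symm hN R cf cH h0 H0
  have a3 : ∀ j : Fin N, ∫ x in Metric.closedBall (0 : Euc N) R, epartial j f x * (x j * epV N f x)
     = - (∫ x in Metric.closedBall (0 : Euc N) R, f x * epV N f x) -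
      ∫ x in Metric.closedBall (0 : Euc N) R, f x * (x j * epartial j (epV N f) x) := by
    intro j
    have cx : ContDiff ℝ 1 (fun x : Euc N => x j) := by fun_prop
    rw [ep_ibp hf (cx.mul V1) h0 j, neg_sub_left, neg_inj,
      ← integral_add (ep_intOn R (by fun_prop)) (ep_intOn R (by fun_prop))]
    congr 1; funext x
    have : epartial j (fun x : Euc N => x j) x = 1 := by
      unfold epartial
      have : HasFDerivAt (fun x : Euc N => x j) (EuclideanSpace.proj j : Euc N →L[ℝ] ℝ) x :=
        (EuclideanSpace.proj j : Euc N →L[ℝ] ℝ).hasFDerivAt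
      rw [this.fderiv]; simp
    have h2 := ep_mul cx V1 j x
    rw [this] at h2
    change f x * epartial j (fun y : Euc N => y j * epV N f y) x = _
    rw [h2]; ring
  have a4 : ∫ x in Metric.closedBall (0 : Euc N) R, (∑ j, x j * epartial j f x) * epV N f x
     = ∑ j, ∫ x in Metric.closedBall (0 : Euc N) R, epartial j f x * (x j * epV N f x) := by
    rw [← integral_finsetSum _ (fun j _ => ep_intOn R (by fun_prop))]
    congr 1; funext x
    rw [Finset.sum_mul]
    congr 1; funext j; ring
  have a5 : ∫ x in Metric.closedBall (0 : Euc N) R, f x * ∑ j, x j * epartial j (epV N f) x =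
     ∑ j, ∫ x in Metric.closedBall (0 : Euc N) R, f x * (x j * epartial j (epV N f) x) := by
    rw [← integral_finsetSum _ (fun j _ => ep_intOn R (by fun_prop))]
    simp only [Finset.mul_sum]
  rw [a4] at a2
  simp only [a3] at a2
  rw [Finset.sum_sub_distrib, ← a5] at a2
  simp only [Finset.sum_const, Finset.card_univ, Fintype.card_fin, nsmul_eq_mul] at a2
  linarith

lemma ep_const_mul {N : ℕ} {f : Euc N → ℝ} (c : ℝ) (hf : ContDiff ℝ 1 f) (i : Fin N) (x : Euc N) :
    epartial i (fun y => c * f y) x = c * epartial i f x := by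
  unfold epartial
  rw [fderiv_const_mul (hf.differentiable (by norm_num) x)]
  simp

lemma ep_coord {N : ℕ} (i j : Fin N) (x : Euc N) :
    epartial i (fun y : Euc N => y j) x = if i = j then 1 else 0 := by
  unfold epartial
  have : HasFDerivAt (fun x : Euc N => x j) (EuclideanSpace.proj j : Euc N →L[ℝ] ℝ) x :=
    (EuclideanSpace.proj j : Euc N →L[ℝ] ℝ).hasFDerivAt
  rw [this.fderiv]
  simp [eq_comm]

lemma ep_normsq {N : ℕ} (i : Fin N) (x : Euc N) :
    epartial i (fun y : Euc N => ‖y‖ ^ 2) x = 2 * x i := by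
  unfold epartial
  rw [fderiv_norm_sq_apply]
  simp [EuclideanSpace.inner_single_right]

lemma ep_S1 {N : ℕ} {R : ℝ} (r : Euc N → ℝ) (v : Fin N → Euc N → ℝ) (hr : ContDiff ℝ 1 r)
    (hv : ∀ i, ContDiff ℝ 1 (v i))
    (h0 : ∀ x, x ∉ Metric.closedBall (0 : Euc N) R → r x = 0) :
    ∫ x in Metric.closedBall (0 : Euc N) R, (-(∑ i, epartial i (fun y => r y * v i y) x)) * ‖x‖ ^ 2
     = 2 * ∫ x in Metric.closedBall (0 : Euc N) R, ∑ i, x i * (r x * v i x) := by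
  have hm : ∀ i, ContDiff ℝ 1 (fun y => r y * v i y) := fun i => hr.mul (hv i)
  have cm : ∀ i, Continuous (fun y => r y * v i y) := fun i => (hm i).continuous
  have cp : ∀ i, Continuous (epartial i (fun y => r y * v i y)) := fun i => ep_cont_epartial (hm i) i
  have hx : ContDiff ℝ 1 (fun y : Euc N => ‖y‖ ^ 2) := contDiff_norm_sq ℝ
  have e : ∀ i, ∫ x in Metric.closedBall (0 : Euc N) R, epartial i (fun y => r y * v i y) x * ‖x‖ ^ 2
     = - ∫ x in Metric.closedBall (0 : Euc N) R, (r x * v i x) * (2 * x i) := by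
    intro i
    rw [ep_ibp (hm i) hx (fun x hx => by simp [h0 x hx])]
    simp only [ep_normsq]
  simp only [neg_mul, Finset.sum_mul, integral_neg]
  rw [integral_finsetSum _ (fun i _ => ep_intOn R (by fun_prop)),
    integral_finsetSum _ (fun i _ => ep_intOn R ?_)]
  · simp only [e, Finset.sum_neg_distrib, neg_neg, Finset.mul_sum, ← integral_const_mul]
    congr 1; funext i; congr 1; funext x; ring
  · have := cm i
    fun_prop

lemma ep_S2 {N : ℕ} {R : ℝ} (hN : 4 ≤ N) (hR : 0 ≤ R) (K g β : ℝ) (r P : Euc N → ℝ)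
    (v : Fin N → Euc N → ℝ) (hr : ContDiff ℝ 1 r) (hP : ContDiff ℝ 1 P)
    (hv : ∀ i, ContDiff ℝ 1 (v i))
    (h0 : ∀ x, x ∉ Metric.closedBall (0 : Euc N) R → r x = 0)
    (hP0 : ∀ x, x ∉ Metric.closedBall (0 : Euc N) R → P x = 0) :
    ∫ x in Metric.closedBall (0 : Euc N) R, ∑ j, x j * 
      (-(∑ i, epartial i (fun y => r y * v i y * v j y) x) - K * epartial j P x
        - r x * (g * epartial j (epV N r) x) - β * (r x * v j x)) =
     (∫ x in Metric.closedBall (0 : Euc N) R, r x * ∑ j, v j x ^ 2)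
      + N * (K * ∫ x in Metric.closedBall (0 : Euc N) R, P x)
      + g * (((N : ℝ) - 2) / 2) * (∫ x in Metric.closedBall (0 : Euc N) R, r x * epV N r x)
      - β * ∫ x in Metric.closedBall (0 : Euc N) R, ∑ j, x j * (r x * v j x) := by
  have hV := epV_C1 hN hr h0
  have cx : ∀ j, ContDiff ℝ 1 (fun x : Euc N => x j) := fun j => by fun_prop
  have hm : ∀ i j, ContDiff ℝ 1 (fun y => r y * v i y * v j y) := fun i j =>
    (hr.mul (hv i)).mul (hv j)
  have hF : ∀ i j, ContDiff ℝ 1 (fun y => r y * v i y * v j y * y j) := fun i j =>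
    (hm i j).mul (cx j)
  have hG : ∀ j, ContDiff ℝ 1 (fun y => P y * y j) := fun j => hP.mul (cx j)
  have cF : ∀ i j, Continuous (epartial i (fun y => r y * v i y * v j y * y j)) :=
    fun i j => ep_cont_epartial (hF i j) i
  have cG : ∀ j, Continuous (epartial j (fun y => P y * y j)) := fun j => ep_cont_epartial (hG j) j
  have cV : ∀ j, Continuous (epartial j (epV N r)) := fun j => ep_cont_epartial hV j
  have cr := hr.continuous
  have cv : ∀ i, Continuous (v i) := fun i => (hv i).continuous
  have cP := hP.continuous
  have pt : ∀ x : Euc N, ∑ j, x j * 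
      (-(∑ i, epartial i (fun y => r y * v i y * v j y) x) - K * epartial j P x
        - r x * (g * epartial j (epV N r) x) - β * (r x * v j x)) =
      r x * ∑ j, v j x ^ 2 + N * (K * P x) - g * (r x * ∑ j, x j * epartial j (epV N r) x)
      - β * ∑ j, x j * (r x * v j x)
      - ∑ j, ∑ i, epartial i (fun y => r y * v i y * v j y * y j) x
      - K * ∑ j, epartial j (fun y => P y * y j) x := by
    intro x
    have e1 : ∀ i j, epartial i (fun y => r y * v i y * v j y * y j) x = 
       epartial i (fun y => r y * v i y * v j y) x * x j
        + (if i = j then r x * v i x * v j x else 0) := by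
      intro i j
      rw [ep_mul (hm i j) (cx j), ep_coord]
      simp
    have e2 : ∀ j, epartial j (fun y => P y * y j) x = epartial j P x * x j + P x := by
      intro j
      rw [ep_mul hP (cx j), ep_coord]
      simp
    simp only [e1, e2, Finset.sum_add_distrib, Finset.sum_ite_eq', Finset.mem_univ, if_true,
      Finset.sum_const, Finset.card_univ, Fintype.card_fin, nsmul_eq_mul, mul_sub, mul_neg,
      Finset.sum_sub_distrib, Finset.sum_neg_distrib, Finset.mul_sum, mul_add]
    have e3 : ∑ j, ∑ i, x j * epartial i (fun y => r y * v i y * v j y) x = 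
      ∑ j, ∑ i, epartial i (fun y => r y * v i y * v j y) x * x j := by
      simp only [mul_comm]
    have e4 : ∑ j, r x * v j x ^ 2 = ∑ j, r x * v j x * v j x := by
      congr 1; funext j; ring
    have e5 : ∑ j, x j * (K * epartial j P x) = ∑ j, K * (epartial j P x * x j) := by
      congr 1; funext j; ring
    have e6 : ∑ j, x j * (r x * (g * epartial j (epV N r) x)) = 
        ∑ j, g * (r x * (x j * epartial j (epV N r) x)) := by
      congr 1; funext j; ring
    have e7 : ∑ j, x j * (β * (r x * v j x)) = ∑ j, β * (x j * (r x * v j x)) := by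
      congr 1; funext j; ring
    rw [e3, e4, e5, e6, e7]
    ring
  simp only [pt]
  have z1 : ∫ x in Metric.closedBall (0 : Euc N) R,
      ∑ j, ∑ i, epartial i (fun y => r y * v i y * v j y * y j) x = 0 := by
    rw [integral_finsetSum _ (fun j _ => ep_intOn R (by fun_prop))]
    refine Finset.sum_eq_zero fun j _ => ?_
    rw [integral_finsetSum _ (fun i _ => ep_intOn R (by fun_prop))]
    exact Finset.sum_eq_zero fun i _ =>
      ep_int_partial (hF i j) (fun x hx => by simp [h0 x hx]) i
  have z2 : ∫ x in Metric.closedBall (0 : Euc N) R, ∑ j, epartial j (fun y => P y * y j) x = 0 := by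
    rw [integral_finsetSum _ (fun j _ => ep_intOn R (by fun_prop))]
    exact Finset.sum_eq_zero fun i _ =>
      ep_int_partial (hG i) (fun x hx => by simp [hP0 x hx]) i
  have vir := ep_virial hN hr hR h0
  rw [integral_sub (ep_intOn R (by fun_prop)) (ep_intOn R (by fun_prop)),
    integral_sub (ep_intOn R (by fun_prop)) (ep_intOn R (by fun_prop)),
    integral_sub (ep_intOn R (by fun_prop)) (ep_intOn R (by fun_prop)),
    integral_sub (ep_intOn R (by fun_prop)) (ep_intOn R (by fun_prop)),
    integral_add (ep_intOn R (by fun_prop)) (ep_intOn R (by fun_prop))]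
  simp only [integral_const_mul, z1, z2, vir]
  ring

lemma ep_S3 {N : ℕ} {R : ℝ} (hN : 4 ≤ N) (K g β γ : ℝ) (hγ : 1 < γ) (r P q : Euc N → ℝ)
    (v : Fin N → Euc N → ℝ) (hr : ContDiff ℝ 1 r) (hP : ContDiff ℝ 1 P)
    (hv : ∀ i, ContDiff ℝ 1 (v i))
    (h0 : ∀ x, x ∉ Metric.closedBall (0 : Euc N) R → r x = 0)
    (hP0 : ∀ x, x ∉ Metric.closedBall (0 : Euc N) R → P x = 0)
    (hPq : ∀ x i, epartial i P x = γ * q x * epartial i r x) (hrq : ∀ x, r x * q x = P x)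
    (a : Euc N → ℝ) (ha : ∀ x, a x = -(∑ i, epartial i (fun y => r y * v i y) x)) 
    (n : Fin N → Euc N → ℝ)
    (hn : ∀ j x, n j x = -(∑ i, epartial i (fun y => r y * v i y * v j y) x) - K * epartial j P x
        - r x * (g * epartial j (epV N r) x) - β * (r x * v j x)) :
    ∫ x in Metric.closedBall (0 : Euc N) R, ((∑ j, v j x * n j x - (1 / 2) * a x * ∑ j, v j x ^ 2)
      + K / (γ - 1) * (γ * q x * a x) + g * (a x * epV N r x)) = 
     -β * ∫ x in Metric.closedBall (0 : Euc N) R, r x * ∑ j, v j x ^ 2 := by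
  have hV := epV_C1 hN hr h0
  have hm : ∀ i, ContDiff ℝ 1 (fun y => r y * v i y) := fun i => hr.mul (hv i)
  have hF : ∀ i j, ContDiff ℝ 1 (fun y => r y * v i y * v j y * v j y) := fun i j =>
    ((hm i).mul (hv j)).mul (hv j)
  have hG : ∀ j, ContDiff ℝ 1 (fun y => P y * v j y) := fun j => hP.mul (hv j)
  have hH : ∀ j, ContDiff ℝ 1 (fun y => r y * v j y * epV N r y) := fun j => (hm j).mul hV
  have cF : ∀ i j, Continuous (epartial i (fun y => r y * v i y * v j y * v j y)) :=
    fun i j => ep_cont_epartial (hF i j) i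
  have cG : ∀ j, Continuous (epartial j (fun y => P y * v j y)) := fun j => ep_cont_epartial (hG j) j
  have cH : ∀ j, Continuous (epartial j (fun y => r y * v j y * epV N r y)) :=
    fun j => ep_cont_epartial (hH j) j
  have cr := hr.continuous
  have cv : ∀ i, Continuous (v i) := fun i => (hv i).continuous
  have hγ' : γ - 1 ≠ 0 := by linarith
  have pt : ∀ x : Euc N, ((∑ j, v j x * n j x - (1 / 2) * a x * ∑ j, v j x ^ 2)
      + K / (γ - 1) * (γ * q x * a x) + g * (a x * epV N r x)) = 
      -β * (r x * ∑ j, v j x ^ 2)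
      - (1 / 2) * ∑ j, ∑ i, epartial i (fun y => r y * v i y * v j y * v j y) x
      - K * γ / (γ - 1) * ∑ j, epartial j (fun y => P y * v j y) x
      - g * ∑ j, epartial j (fun y => r y * v j y * epV N r y) x := by
    intro x
    have e0 : ∀ i j, epartial i (fun y => r y * v i y * v j y) x = 
       epartial i (fun y => r y * v i y) x * v j x + r x * v i x * epartial i (v j) x := by
      intro i j
      rw [ep_mul (hm i) (hv j)]
    have e1 : ∀ i j, epartial i (fun y => r y * v i y * v j y * v j y) x = 
       2 * (v j x * epartial i (fun y => r y * v i y * v j y) x) -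
         epartial i (fun y => r y * v i y) x * v j x ^ 2 := by
      intro i j
      rw [ep_mul ((hm i).mul (hv j)) (hv j), e0]
      ring
    have e2 : ∀ j, epartial j (fun y => P y * v j y) x = 
        epartial j P x * v j x + P x * epartial j (v j) x := fun j => ep_mul hP (hv j) j x
    have e3 : ∀ j, epartial j (fun y => r y * v j y * epV N r y) x = 
        epartial j (fun y => r y * v j y) x * epV N r x + r x * v j x * epartial j (epV N r) x :=
      fun j => ep_mul (hm j) hV j x
    have e4 : ∀ j, q x * epartial j (fun y => r y * v j y) x = 
        (1 / γ) * (epartial j P x * v j x) + P x * epartial j (v j) x := by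
      intro j
      rw [ep_mul hr (hv j), hPq, ← hrq]
      have : γ ≠ 0 := by linarith
      field_simp
    have f1 : ∑ j, ∑ i, epartial i (fun y => r y * v i y * v j y * v j y) x = 
        2 * ∑ j, v j x * ∑ i, epartial i (fun y => r y * v i y * v j y) x
        - (∑ i, epartial i (fun y => r y * v i y) x) * ∑ j, v j x ^ 2 := by
      simp only [e1, Finset.sum_sub_distrib, Finset.mul_sum, Finset.sum_mul]
    have f2 : γ * q x * a x = -(∑ j, epartial j P x * v j x) 
        - γ * (P x * ∑ j, epartial j (v j) x) := by
      have : γ * q x * a x = - γ * ∑ j, q x * epartial j (fun y => r y * v j y) x := by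
        rw [ha, ← Finset.mul_sum]; ring
      rw [this]
      simp only [e4, Finset.sum_add_distrib, ← Finset.mul_sum]
      have : γ ≠ 0 := by linarith
      field_simp
      ring
    have f3 : ∑ j, v j x * n j x = - ∑ j, v j x * ∑ i, epartial i (fun y => r y * v i y * v j y) x
        - K * ∑ j, epartial j P x * v j x - g * ∑ j, r x * v j x * epartial j (epV N r) x
        - β * (r x * ∑ j, v j x ^ 2) := by
      simp only [hn, mul_sub, mul_neg, Finset.sum_sub_distrib, Finset.sum_neg_distrib]
      simp only [Finset.mul_sum]
      congr 1
      · congr 1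
        · congr 1
          congr 1; funext j; ring
        · congr 1; funext j; ring
      · congr 1; funext j; ring
    rw [f1, f2, f3]
    simp only [e2, e3, Finset.sum_add_distrib, ← Finset.mul_sum, ← Finset.sum_mul]
    rw [ha]
    field_simp
    ring
  simp only [pt]
  have z1 : ∫ x in Metric.closedBall (0 : Euc N) R,
      ∑ j, ∑ i, epartial i (fun y => r y * v i y * v j y * v j y) x = 0 := by
    rw [integral_finsetSum _ (fun j _ => ep_intOn R (by fun_prop))]
    refine Finset.sum_eq_zero fun j _ => ?_
    rw [integral_finsetSum _ (fun i _ => ep_intOn R (by fun_prop))]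
    exact Finset.sum_eq_zero fun i _ =>
      ep_int_partial (hF i j) (fun x hx => by simp [h0 x hx]) i
  have z2 : ∫ x in Metric.closedBall (0 : Euc N) R, ∑ j, epartial j (fun y => P y * v j y) x = 0 := by
    rw [integral_finsetSum _ (fun j _ => ep_intOn R (by fun_prop))]
    exact Finset.sum_eq_zero fun i _ =>
      ep_int_partial (hG i) (fun x hx => by simp [hP0 x hx]) i
  have z3 : ∫ x in Metric.closedBall (0 : Euc N) R,
      ∑ j, epartial j (fun y => r y * v j y * epV N r y) x = 0 := by
    rw [integral_finsetSum _ (fun j _ => ep_intOn R (by fun_prop))]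
    exact Finset.sum_eq_zero fun i _ =>
      ep_int_partial (hH i) (fun x hx => by simp [h0 x hx]) i
  rw [integral_sub (ep_intOn R (by fun_prop)) (ep_intOn R (by fun_prop)),
    integral_sub (ep_intOn R (by fun_prop)) (ep_intOn R (by fun_prop)),
    integral_sub (ep_intOn R (by fun_prop)) (ep_intOn R (by fun_prop))]
  simp only [integral_const_mul, z1, z2, z3]
  ring

lemma ep_ode (H Q : ℝ → ℝ) (β δ : ℝ) (hβ : 0 < β) (hδ : 0 < δ)
    (hH : ∀ t, 0 ≤ t → HasDerivAt H (2 * Q t) t)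
    (hQ : ∀ t, 0 ≤ t → ∃ q, HasDerivAt Q q t ∧ q + β * Q t ≤ -δ)
    (hH0 : ∀ t, 0 ≤ t → 0 ≤ H t) : False := by
  choose! q hq hq' using hQ
  have anti : ∀ F F' : ℝ → ℝ, (∀ t, 0 ≤ t → HasDerivAt F (F' t) t) → (∀ t, 0 ≤ t → F' t ≤ 0) →
      ∀ t, 0 ≤ t → F t ≤ F 0 := by
    intro F F' h1 h2 t ht
    have : AntitoneOn F (Set.Ici 0) := by
      apply antitoneOn_of_deriv_nonpos (convex_Ici 0)
      · exact fun t ht => (h1 t ht).continuousAt.continuousWithinAt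
      · intro t ht
        rw [interior_Ici] at ht
        exact (h1 t (le_of_lt ht)).differentiableAt.differentiableWithinAt
      · intro t ht
        rw [interior_Ici] at ht
        rw [(h1 t (le_of_lt ht)).deriv]
        exact h2 t (le_of_lt ht)
    exact this (Set.mem_Ici.2 le_rfl) ht ht
  have a1 := anti (fun t => 2 * Q t + β * H t + 2 * δ * t) (fun t => 2 * q t + β * (2 * Q t) + 2 * δ * 1)
    (fun t ht => (((hq t ht).const_mul 2).add ((hH t ht).const_mul β)).add
      ((hasDerivAt_id t).const_mul (2 * δ)))
    (fun t ht => by have := hq' t ht; linarith)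
  set F0 := 2 * Q 0 + β * H 0 + 2 * δ * 0 with hF0
  have a2 := anti (fun t => H t - F0 * t + δ * t ^ 2) (fun t => 2 * Q t - F0 * 1 + δ * (2 * t))
    (fun t ht => ((hH t ht).sub ((hasDerivAt_id t).const_mul F0)).add
      (by simpa using (hasDerivAt_pow 2 t).const_mul δ))
    (fun t ht => by
      have h1 := a1 t ht
      have h2 := mul_nonneg hβ.le (hH0 t ht)
      linarith)
  have hH00 := hH0 0 le_rfl
  set t := (|F0| + H 0 + 1) / δ + 1 with ht
  have h1 : 1 ≤ t := by rw [ht]; have : 0 ≤ (|F0| + H 0 + 1) / δ := by positivity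
                        linarith
  have h2 : δ * t = |F0| + H 0 + 1 + δ := by rw [ht]; field_simp
  have h3 := a2 t (by linarith)
  have h4 := hH0 t (by linarith)
  simp only [mul_zero, sub_zero] at h3
  have h5 : δ * t ^ 2 = (|F0| + H 0 + 1 + δ) * t := by rw [← h2]; ring
  rw [h5] at h3
  have h6 : F0 * t ≤ |F0| * t := by gcongr; exact le_abs_self _
  nlinarith

lemma ep_pressure {N : ℕ} (R M γ : ℝ) (hM : 0 < M) (hγ : 1 < γ) : ∃ δ, 0 < δ ∧ 
    ∀ r : Euc N → ℝ, Continuous r → (∀ x, 0 ≤ r x) → 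
    ∫ x in Metric.closedBall (0 : Euc N) R, r x = M → 
    δ ≤ ∫ x in Metric.closedBall (0 : Euc N) R, r x ^ γ := by
  set V := (volume : Measure (Euc N)).real (Metric.closedBall (0 : Euc N) R) with hV
  have hV0 : 0 ≤ V := measureReal_nonneg
  set ε := M / (2 * (V + 1)) with hε
  have hε0 : 0 < ε := by positivity
  refine ⟨ε ^ (γ - 1) * (M / 2), by positivity, fun r cr r0 hr => ?_⟩
  have cP : Continuous (fun x => r x ^ γ) := cr.rpow_const (fun x => Or.inr (by linarith))
  have pt : ∀ x, ε ^ (γ - 1) * r x ≤ ε ^ (γ - 1) * ε + r x ^ γ := by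
    intro x
    have hp : 0 < ε ^ (γ - 1) := by positivity
    have hp2 : 0 ≤ r x ^ γ := Real.rpow_nonneg (r0 x) _
    rcases le_total (r x) ε with h | h
    · nlinarith
    · have h1 : ε ^ (γ - 1) ≤ r x ^ (γ - 1) := Real.rpow_le_rpow hε0.le h (by linarith)
      have h2 : r x ^ γ = r x ^ (γ - 1) * r x := by
        rw [← Real.rpow_add_one (by linarith)]; congr 1; ring
      rw [h2]
      have := mul_le_mul_of_nonneg_right h1 (r0 x)
      nlinarith
  have h1 := integral_mono (μ := volume.restrict (Metric.closedBall (0 : Euc N) R))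
    (ep_intOn R (continuous_const.fun_mul cr)) (ep_intOn R (continuous_const.fun_add cP)) pt
  rw [integral_const_mul, hr, integral_add (ep_intOn R continuous_const) (ep_intOn R cP)] at h1
  simp only [integral_const, measureReal_restrict_apply_univ, smul_eq_mul] at h1
  rw [← hV] at h1
  have h2 : V * ε ≤ M / 2 := by
    rw [hε]; field_simp; nlinarith
  have h3 : V * (ε ^ (γ - 1) * ε) ≤ ε ^ (γ - 1) * (M / 2) := by
    have := mul_le_mul_of_nonneg_left h2 (show 0 ≤ ε ^ (γ - 1) by positivity)
    linarith
  linarith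

lemma ep_rpow_mul {a γ : ℝ} (ha : 0 ≤ a) (hγ : 1 < γ) : a * a ^ (γ - 1) = a ^ γ := by
  rcases ha.eq_or_lt with h | h
  · rw [← h, zero_mul, Real.zero_rpow (by linarith)]
  · rw [mul_comm, ← Real.rpow_add_one h.ne']; congr 1; ring

lemma ep_int3 {N : ℕ} (R : ℝ) (A B C : Euc N → ℝ) (c d : ℝ) (hA : Continuous A) (hB : Continuous B)
    (hC : Continuous C) :
    ∫ x in Metric.closedBall (0 : Euc N) R, (A x + c * B x + d * C x) =
      (∫ x in Metric.closedBall (0 : Euc N) R, A x) + c * (∫ x in Metric.closedBall (0 : Euc N) R, B x)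
       + d * ∫ x in Metric.closedBall (0 : Euc N) R, C x := by
  rw [integral_add (ep_intOn R (by fun_prop)) (ep_intOn R (by fun_prop)),
      integral_add (ep_intOn R (by fun_prop)) (ep_intOn R (by fun_prop)),
      integral_const_mul, integral_const_mul]

lemma ep_dtime {f : ℝ → ℝ} {t : ℝ} (hf : DifferentiableAt ℝ f t) {c : ℝ} :
    deriv (fun s => f s * c) t = deriv f t * c := deriv_mul_const hf c

set_option maxHeartbeats 800000 in
/-- the time-derivative identities, packaged -/
lemma ep_main {N : ℕ} (hN : 4 ≤ N) (K γ β g : ℝ) (hγ1 : 1 < γ)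
    (Ω : Set (Euc N)) (ρ : ℝ → Euc N → ℝ) (u : ℝ → Euc N → Euc N)
    (hsol : IsEPSolution N K γ β g Ω ⊤ ρ u) (R : ℝ) (hR : 0 ≤ R)
    (hΩ : Ω ⊆ Metric.closedBall 0 R) :
    (∀ t, 0 ≤ t → HasDerivAt (fun t => ∫ x in Metric.closedBall (0 : Euc N) R, ρ t x * ‖x‖ ^ 2)
      (2 * ∫ x in Metric.closedBall (0 : Euc N) R, ∑ j, x j * (ρ t x * u t x j)) t) ∧ 
    (∀ t, 0 ≤ t → HasDerivAt
      (fun t => ∫ x in Metric.closedBall (0 : Euc N) R, ∑ j, x j * (ρ t x * u t x j))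
      ((∫ x in Metric.closedBall (0 : Euc N) R, ρ t x * ∑ j, u t x j ^ 2)
      + N * (K * ∫ x in Metric.closedBall (0 : Euc N) R, ρ t x ^ γ)
      + g * (((N : ℝ) - 2) / 2) * (∫ x in Metric.closedBall (0 : Euc N) R, ρ t x * epV N (ρ t) x)
      - β * ∫ x in Metric.closedBall (0 : Euc N) R, ∑ j, x j * (ρ t x * u t x j)) t) ∧ 
    (∀ t, 0 ≤ t → HasDerivAt
      (fun t => (∫ x in Metric.closedBall (0 : Euc N) R, (1 / 2) * (ρ t x * ∑ j, u t x j ^ 2))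
        + K / (γ - 1) * (∫ x in Metric.closedBall (0 : Euc N) R, ρ t x ^ γ)
        + g / 2 * ∫ p in Metric.closedBall (0 : Euc N) R ×ˢ Metric.closedBall (0 : Euc N) R,
            ρ t p.1 * ρ t p.2 * green N (p.1 - p.2))
      (-β * ∫ x in Metric.closedBall (0 : Euc N) R, ρ t x * ∑ j, u t x j ^ 2) t) := by
  have hρ := hsol.rho_C1
  have hu : ∀ j, ContDiff ℝ 1 (fun p : ℝ × Euc N => u p.1 p.2 j) := by
    intro j
    exact (EuclideanSpace.proj j : Euc N →L[ℝ] ℝ).contDiff.comp hsol.u_C1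
  have hP : ContDiff ℝ 1 (fun p : ℝ × Euc N => ρ p.1 p.2 ^ γ) := by
    have := ContDiff.rpow_const_of_le (m := 1) (p := γ) (by exact_mod_cast hρ)
      (by exact_mod_cast hγ1.le)
    exact_mod_cast this
  have slice : ∀ (f : ℝ × Euc N → ℝ), ContDiff ℝ 1 f → ∀ t, ContDiff ℝ 1 (fun x => f (t, x)) :=
    fun f hf t => hf.comp (contDiff_const.prodMk contDiff_id)
  have tslice : ∀ (f : ℝ × Euc N → ℝ), ContDiff ℝ 1 f → ∀ t x,
      DifferentiableAt ℝ (fun s => f (s, x)) t :=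
    fun f hf t x => (hf.comp (contDiff_id.prodMk contDiff_const)).differentiable (by norm_num) t
  have ctd : ∀ (f : ℝ × Euc N → ℝ), ContDiff ℝ 1 f → ∀ t,
      Continuous (fun x => deriv (fun s => f (s, x)) t) := by
    intro f hf t
    have hd : ∀ x, deriv (fun s => f (s, x)) t = fderiv ℝ f (t, x) (1, 0) := by
      intro x
      have h1 : HasFDerivAt f (fderiv ℝ f (t, x)) (t, x) :=
        (hf.differentiable (by norm_num) _).hasFDerivAt
      have h2 : HasDerivAt (fun s : ℝ => (s, x)) ((1 : ℝ), (0 : Euc N)) t :=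
        (hasDerivAt_id t).prodMk (hasDerivAt_const t x)
      exact (h1.comp_hasDerivAt t h2).deriv
    simp only [hd]
    have := (hf.continuous_fderiv (by norm_num))
    fun_prop
  have hr : ∀ t, ContDiff ℝ 1 (ρ t) := slice _ hρ
  have hv : ∀ t j, ContDiff ℝ 1 (fun x => u t x j) := fun t j => slice _ (hu j) t
  have hPt : ∀ t, ContDiff ℝ 1 (fun x => ρ t x ^ γ) := slice _ hP
  have dρ : ∀ t x, DifferentiableAt ℝ (fun s => ρ s x) t := tslice _ hρ
  have du : ∀ j t x, DifferentiableAt ℝ (fun s => u s x j) t := fun j => tslice _ (hu j)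
  have cρt : ∀ t, Continuous (fun x => deriv (fun s => ρ s x) t) := ctd _ hρ
  have hut : ∀ j t, Continuous (fun x => deriv (fun s => u s x j) t) := fun j => ctd _ (hu j)
  have cr : ∀ t, Continuous (ρ t) := fun t => (hr t).continuous
  have cv : ∀ t j, Continuous (fun x => u t x j) := fun t j => (hv t j).continuous
  have h0 : ∀ t, 0 ≤ t → ∀ x, x ∉ Metric.closedBall (0 : Euc N) R → ρ t x = 0 := by
    intro t ht x hx
    by_contra h
    exact hx (hΩ (hsol.support_subset t ht (EReal.coe_lt_top t) h))
  have hP0 : ∀ t, 0 ≤ t → ∀ x, x ∉ Metric.closedBall (0 : Euc N) R → ρ t x ^ γ = 0 := by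
    intro t ht x hx
    rw [h0 t ht x hx, Real.zero_rpow (by linarith)]
  have ha : ∀ t, 0 ≤ t → ∀ x, deriv (fun s => ρ s x) t =
      -(∑ i, epartial i (fun y => ρ t y * u t y i) x) := by
    intro t ht x
    have := hsol.continuity_eq t ht (EReal.coe_lt_top t) x
    simp only [ediv, PiLp.smul_apply, smul_eq_mul] at this
    simp only [epartial]
    linarith
  have hn : ∀ t, 0 ≤ t → ∀ j x, deriv (fun s => ρ s x * u s x j) t = 
      -(∑ i, epartial i (fun y => ρ t y * u t y i * u t y j) x)
        - K * epartial j (fun y => ρ t y ^ γ) x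
        - ρ t x * (g * epartial j (epV N (ρ t)) x) - β * (ρ t x * u t x j) := by
    intro t ht j x
    have := hsol.momentum_eq t ht (EReal.coe_lt_top t) x j
    rw [ep_const_mul K (hPt t)] at this
    have h2 : potential N g ρ t = fun x => g * epV N (ρ t) x := rfl
    rw [h2, ep_const_mul g (epV_C1 hN (hr t) (h0 t ht))] at this
    linarith
  have cq : ∀ t, Continuous (fun x => ρ t x ^ (γ - 1)) := fun t =>
    (cr t).rpow_const (fun x => Or.inr (by linarith))
  refine ⟨fun t ht => ?_, fun t ht => ?_, fun t ht => ?_⟩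
  · have hF : ContDiff ℝ 1 (fun p : ℝ × Euc N => ρ p.1 p.2 * ‖p.2‖ ^ 2) :=
      hρ.mul ((contDiff_norm_sq ℝ).comp contDiff_snd)
    have := ep_hasDerivAt_param' _ hF (Metric.closedBall (0 : Euc N) R) (isCompact_closedBall _ _) t
    simp only [ep_dtime (dρ t _), ha t ht] at this
    rw [ep_S1 (ρ t) (fun i x => u t x i) (hr t) (hv t) (h0 t ht)] at this
    exact this
  · have hF : ContDiff ℝ 1 (fun p : ℝ × Euc N => ∑ j, p.2 j * (ρ p.1 p.2 * u p.1 p.2 j)) := by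
      apply ContDiff.sum
      intro j _
      have h1 : ContDiff ℝ 1 (fun p : ℝ × Euc N => p.2 j) := by fun_prop
      exact h1.mul (hρ.mul (hu j))
    have := ep_hasDerivAt_param' _ hF (Metric.closedBall (0 : Euc N) R) (isCompact_closedBall _ _) t
    have hd : ∀ x : Euc N, deriv (fun s => ∑ j, x j * (ρ s x * u s x j)) t =
        ∑ j, x j * deriv (fun s => ρ s x * u s x j) t := by
      intro x
      rw [deriv_fun_sum (fun j _ => ((dρ t x).fun_mul (du j t x)).const_mul _)]
      congr 1; funext j
      exact deriv_const_mul _ ((dρ t x).fun_mul (du j t x))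
    simp only [hd, hn t ht] at this
    rw [ep_S2 hN hR K g β (ρ t) (fun x => ρ t x ^ γ) (fun i x => u t x i) (hr t) (hPt t) (hv t)
      (h0 t ht) (hP0 t ht)] at this
    exact this
  · have hF1 : ContDiff ℝ 1 (fun p : ℝ × Euc N => (1 / 2) * (ρ p.1 p.2 * ∑ j, u p.1 p.2 j ^ 2)) := by
      apply contDiff_const.mul
      apply hρ.mul
      apply ContDiff.sum
      intro j _
      exact (hu j).pow 2
    have k1 := ep_hasDerivAt_param' _ hF1 (Metric.closedBall (0 : Euc N) R)
      (isCompact_closedBall _ _) t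
    have hd1 : ∀ x : Euc N, deriv (fun s => (1 / 2) * (ρ s x * ∑ j, u s x j ^ 2)) t =
        ∑ j, u t x j * deriv (fun s => ρ s x * u s x j) t 
        - (1 / 2) * deriv (fun s => ρ s x) t * ∑ j, u t x j ^ 2 := by
      intro x
      have e1 : ∀ j, deriv (fun s => ρ s x * u s x j) t = 
          deriv (fun s => ρ s x) t * u t x j + ρ t x * deriv (fun s => u s x j) t :=
        fun j => deriv_fun_mul (dρ t x) (du j t x)
      have e2 : HasDerivAt (fun s => ∑ j, u s x j ^ 2)
          (∑ j, (2 : ℕ) * u t x j ^ (2 - 1) * deriv (fun s => u s x j) t) t :=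
        HasDerivAt.fun_sum (fun j _ => (du j t x).hasDerivAt.fun_pow 2)
      have e3 := (((dρ t x).hasDerivAt.fun_mul e2).const_mul (1 / 2 : ℝ)).deriv
      rw [e3]
      simp only [e1, mul_add, Finset.sum_add_distrib, Finset.mul_sum]
      rw [← Finset.sum_add_distrib, ← Finset.sum_add_distrib, ← Finset.sum_sub_distrib]
      congr 1; funext j
      push_cast
      ring
    simp only [hd1] at k1
    have k2 := ep_hasDerivAt_param' _ hP (Metric.closedBall (0 : Euc N) R)
      (isCompact_closedBall _ _) t
    have hd2 : ∀ x : Euc N, deriv (fun s => ρ s x ^ γ) t = 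
        γ * ρ t x ^ (γ - 1) * deriv (fun s => ρ s x) t := by
      intro x
      rw [((dρ t x).hasDerivAt.rpow_const (Or.inr hγ1.le)).deriv]
      ring
    simp only [hd2] at k2
    have hF3 : ContDiff ℝ 1 (fun p : ℝ × (Euc N × Euc N) => ρ p.1 p.2.1 * ρ p.1 p.2.2) :=
      (hρ.comp (g := fun p : ℝ × Euc N => ρ p.1 p.2)
        (f := fun p : ℝ × (Euc N × Euc N) => (p.1, p.2.1)) (by fun_prop)).mul
      (hρ.comp (g := fun p : ℝ × Euc N => ρ p.1 p.2)
        (f := fun p : ℝ × (Euc N × Euc N) => (p.1, p.2.2)) (by fun_prop))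
    have k3 := ep_hasDerivAt_param volume _ hF3
      (Metric.closedBall (0 : Euc N) R ×ˢ Metric.closedBall (0 : Euc N) R)
      ((isCompact_closedBall _ _).prod (isCompact_closedBall _ _)) _ (ep_prod_int hN R) t
    have hd3 : ∀ p : Euc N × Euc N, deriv (fun s => ρ s p.1 * ρ s p.2) t * green N (p.1 - p.2) = 
        deriv (fun s => ρ s p.1) t * ρ t p.2 * green N (p.1 - p.2)
        + ρ t p.1 * deriv (fun s => ρ s p.2) t * green N (p.1 - p.2) := by
      intro p
      rw [deriv_fun_mul (dρ t _) (dρ t _)]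
      ring
    simp only [hd3] at k3
    have crt := cr t
    have cat := cρt t
    rw [integral_add (ep_prod_int' hN R (F := fun p => deriv (fun s => ρ s p.1) t * ρ t p.2)
        ((cat.comp continuous_fst).mul (crt.comp continuous_snd)))
      (ep_prod_int' hN R (F := fun p => ρ t p.1 * deriv (fun s => ρ s p.2) t) 
        ((crt.comp continuous_fst).mul (cat.comp continuous_snd))),
      ep_double hN R (f := fun x => deriv (fun s => ρ s x) t) cat crt (h0 t ht),
      ep_double' hN R (h := fun x => deriv (fun s => ρ s x) t) crt cat (h0 t ht)] at k3
    have S3 := ep_S3 hN K g β γ hγ1 (ρ t) (fun x => ρ t x ^ γ) (fun x => ρ t x ^ (γ - 1))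
      (fun i x => u t x i) (hr t) (hPt t) (hv t) (h0 t ht) (hP0 t ht) 
      (by
        intro x i
        unfold epartial
        have h1 : HasFDerivAt (ρ t) (fderiv ℝ (ρ t) x) x :=
          ((hr t).differentiable (by norm_num) x).hasFDerivAt
        rw [(h1.rpow_const (Or.inr hγ1.le)).fderiv]
        simp)
      (fun x => ep_rpow_mul (hsol.rho_nonneg t x) hγ1) (fun x => deriv (fun s => ρ s x) t)
      (ha t ht) (fun j x => deriv (fun s => ρ s x * u s x j) t) (hn t ht)
    have cV := epV_cont hN crt (h0 t ht)
    have cqt := cq t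
    have cut := fun j => hut j t
    have cvt := cv t
    have cnt : ∀ j, Continuous (fun x => deriv (fun s => ρ s x * u s x j) t) := fun j =>
      ctd _ (hρ.mul (hu j)) t
    have cA : Continuous (fun x => ∑ j, u t x j * deriv (fun s => ρ s x * u s x j) t 
        - (1 / 2) * deriv (fun s => ρ s x) t * ∑ j, u t x j ^ 2) :=
      (continuous_finsetSum _ fun j _ => (cvt j).mul (cnt j)).sub
        ((continuous_const.mul cat).mul (continuous_finsetSum _ fun j _ => (cvt j).pow 2))
    have cB : Continuous (fun x => γ * ρ t x ^ (γ - 1) * deriv (fun s => ρ s x) t) :=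
      (continuous_const.mul cqt).mul cat
    have S4 := (ep_int3 R _ _ _ (K / (γ - 1)) g cA cB (cat.mul cV)).symm.trans S3
    rw [← S4]
    refine ((k1.add (k2.const_mul (K / (γ - 1)))).add (k3.const_mul (g / 2))).congr_deriv ?_
    simp only [Pi.mul_apply]
    ring
/-- For `N ≥ 4`, `β > 0` and `1 < γ < 2(N-1)/N`, there is no
global classical solution with positive total mass of the damped
Euler–Poisson equations whose initial total energy satisfies `E(0) ≤ 0`. -/
theorem blowup_damped_nonpositive_energy (N : ℕ) (hN : 4 ≤ N) (K γ β g : ℝ)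
    (hK : 0 < K) (hg : 0 < g) (hβ : 0 < β)
    (hγ1 : 1 < γ) (hγ2 : γ < 2 * ((N : ℝ) - 1) / N)
    (Ω : Set (Euc N)) (ρ : ℝ → Euc N → ℝ) (u : ℝ → Euc N → Euc N)
    (hsol : IsEPSolution N K γ β g Ω ⊤ ρ u)
    (M : ℝ) (hM : ∀ t : ℝ, 0 ≤ t → (∫ x in Ω, ρ t x) = M) (hMpos : 0 < M)
    (hE0 : energy N K γ g Ω ρ u 0 ≤ 0) :
    False := by
  obtain ⟨R', hR'⟩ := hsol.omega_bounded.subset_closedBall (0 : Euc N)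
  set R := max R' 0 with hRdef
  have hR : 0 ≤ R := le_max_right _ _
  have hΩ : Ω ⊆ Metric.closedBall 0 R :=
    hR'.trans (Metric.closedBall_subset_closedBall (le_max_left _ _))
  obtain ⟨m1, m2, m3⟩ := ep_main hN K γ β g hγ1 Ω ρ u hsol R hR hΩ
  have cr : ∀ t, Continuous (ρ t) := fun t =>
    hsol.rho_C1.continuous.comp (f := fun x => (t, x)) (by fun_prop)
  have cu : ∀ t, Continuous (u t) := fun t =>
    hsol.u_C1.continuous.comp (f := fun x => (t, x)) (by fun_prop)
  have cuj : ∀ t j, Continuous (fun x => u t x j) := fun t j => by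
    have := cu t
    fun_prop
  have h00 : ∀ t, 0 ≤ t → ∀ x, x ∉ Ω → ρ t x = 0 := by
    intro t ht x hx
    by_contra h
    exact hx (hsol.support_subset t ht (EReal.coe_lt_top t) h)
  have h0 : ∀ t, 0 ≤ t → ∀ x, x ∉ Metric.closedBall (0 : Euc N) R → ρ t x = 0 :=
    fun t ht x hx => h00 t ht x (fun h => hx (hΩ h))
  have toB : ∀ f : Euc N → ℝ, (∀ x, x ∉ Ω → f x = 0) →
      ∫ x in Ω, f x = ∫ x in Metric.closedBall (0 : Euc N) R, f x := by
    intro f hf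
    rw [setIntegral_eq_integral_of_forall_compl_eq_zero hf,
      ep_setint (fun x hx => hf x (fun h => hx (hΩ h)))]
  obtain ⟨δ, hδ, hδ'⟩ := ep_pressure (N := N) R M γ hMpos hγ1
  have hNR : (4 : ℝ) ≤ N := by exact_mod_cast hN
  set Kin : ℝ → ℝ := fun t => ∫ x in Metric.closedBall (0 : Euc N) R, ρ t x * ∑ j, u t x j ^ 2 with hKin
  set Pr : ℝ → ℝ := fun t => ∫ x in Metric.closedBall (0 : Euc N) R, ρ t x ^ γ with hPr
  set W : ℝ → ℝ := fun t => ∫ x in Metric.closedBall (0 : Euc N) R, ρ t x * epV N (ρ t) x with hW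
  have Kin0 : ∀ t, 0 ≤ Kin t := fun t => integral_nonneg fun x =>
    mul_nonneg (hsol.rho_nonneg t x) (Finset.sum_nonneg fun j _ => sq_nonneg _)
  have PrL : ∀ t, 0 ≤ t → δ ≤ Pr t := by
    intro t ht
    refine hδ' (ρ t) (cr t) (hsol.rho_nonneg t) ?_
    rw [← toB _ (h00 t ht), hM t ht]
  have dbl : ∀ t, 0 ≤ t → 
      ∫ p in Metric.closedBall (0 : Euc N) R ×ˢ Metric.closedBall (0 : Euc N) R,
            ρ t p.1 * ρ t p.2 * green N (p.1 - p.2) = W t :=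
    fun t ht => ep_double hN R (cr t) (cr t) (h0 t ht)
  have En : ∀ t, 0 ≤ t → (1 / 2) * Kin t + K / (γ - 1) * Pr t + g / 2 * W t ≤ 0 := by
    intro t ht
    have anti : AntitoneOn (fun t => (∫ x in Metric.closedBall (0 : Euc N) R, (1 / 2) * (ρ t x * ∑ j, u t x j ^ 2))
        + K / (γ - 1) * (∫ x in Metric.closedBall (0 : Euc N) R, ρ t x ^ γ)
        + g / 2 * ∫ p in Metric.closedBall (0 : Euc N) R ×ˢ Metric.closedBall (0 : Euc N) R,
            ρ t p.1 * ρ t p.2 * green N (p.1 - p.2)) (Set.Ici 0) := by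
      apply antitoneOn_of_deriv_nonpos (convex_Ici 0)
      · exact fun t ht => (m3 t ht).continuousAt.continuousWithinAt
      · intro t ht
        rw [interior_Ici] at ht
        exact (m3 t (le_of_lt ht)).differentiableAt.differentiableWithinAt
      · intro t ht
        rw [interior_Ici] at ht
        rw [(m3 t (le_of_lt ht)).deriv]
        have := mul_nonneg hβ.le (Kin0 t)
        rw [neg_mul]
        exact neg_nonpos.2 this
    have h1 := anti (Set.mem_Ici.2 le_rfl) ht ht
    simp only [dbl t ht, dbl 0 le_rfl, integral_const_mul] at h1
    refine h1.trans ?_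
    refine le_of_eq_of_le ?_ hE0
    unfold energy
    rw [toB _ (fun x hx => by
      rw [h00 0 le_rfl x hx, Real.zero_rpow (by linarith)]; simp)]
    have hc := cr 0
    have hcu := cuj 0
    have hcV := epV_cont hN hc (h0 0 le_rfl)
    have hcP : Continuous (fun x => ρ 0 x ^ γ) := hc.rpow_const (fun x => Or.inr (by linarith))
    simp only [hW]
    rw [← integral_const_mul, ← integral_const_mul, ← integral_const_mul,
      ← integral_add (ep_intOn R (by fun_prop)) (ep_intOn R (by fun_prop)),
      ← integral_add (ep_intOn R (by fun_prop)) (ep_intOn R (by fun_prop))]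
    congr 1; funext x
    rw [EuclideanSpace.real_norm_sq_eq]
    have : potential N g ρ 0 x = g * epV N (ρ 0) x := rfl
    rw [this]
    ring
  have hc : (N : ℝ) * (γ - 1) < N - 2 := by
    rw [lt_div_iff₀ (by linarith)] at hγ2
    linarith
  have hγ' : 0 < γ - 1 := by linarith
  set c := ((N : ℝ) - 2) / (γ - 1) - N with hcdef
  have hcpos : 0 < c := by
    rw [hcdef, sub_pos, lt_div_iff₀ hγ']
    exact hc
  refine ep_ode _ _ β (c * K * δ) hβ (by positivity) m1 (fun t ht => ⟨_, m2 t ht, ?_⟩) ?_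
  · have e := En t ht
    have k0 := Kin0 t
    have p0 := mul_le_mul_of_nonneg_left (PrL t ht) (show 0 ≤ c * K by positivity)
    change (Kin t + N * (K * Pr t) + g * (((N : ℝ) - 2) / 2) * W t - β * _) + β * _ ≤ _
    rw [sub_add_cancel]
    have e2 := mul_le_mul_of_nonneg_left e (show 0 ≤ (N : ℝ) - 2 by linarith)
    have e3 : ((N : ℝ) - 2) * (1 / 2 * Kin t + K / (γ - 1) * Pr t + g / 2 * W t) = 
      ((N : ℝ) - 2) / 2 * Kin t + (c + N) * K * Pr t + g * (((N : ℝ) - 2) / 2) * W t := by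
      rw [hcdef]; field_simp; ring
    rw [e3] at e2
    nlinarith
  · intro t ht
    exact integral_nonneg fun x => mul_nonneg (hsol.rho_nonneg t x) (sq_nonneg _)
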